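/- arXiv:1608.07309 — 8 statements merged into one kernel-verified Lean document; each statement's English description precedes it below -/
import Mathlib

section
/- Let α ≥ 0 be a real number, let E : ℝ³ → ℝ be continuously differentiable, and let m : ℝ → ℝ³ be differentiable and satisfy the Landau–Lifshitz equation m'(t) = −m(t) × h(t) − α m(t) × (m(t) × h(t)) with effective field h(t) := −∇E(m(t)). Then the energy t ↦ E(m(t)) is nonincreasing (the Lyapunov structure of the Landau–Lifshitz equation). -/
open RealInnerProductSpace

noncomputable section

/-- Three-dimensional Euclidean space. -/
abbrev E3 := EuclideanSpace ℝ (Fin 3)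

/-- The cross product on `E3`. -/
def cross3 (a b : E3) : E3 :=
  (WithLp.equiv 2 (Fin 3 → ℝ)).symm
    (crossProduct ((WithLp.equiv 2 (Fin 3 → ℝ)) a) ((WithLp.equiv 2 (Fin 3 → ℝ)) b))

theorem cross3_ineq (α : ℝ) (hα : 0 ≤ α) (a g : E3) :
    inner ℝ g (-cross3 a (-g) - α • cross3 a (cross3 a (-g))) ≤ 0 := by
  have key : inner ℝ g (-cross3 a (-g) - α • cross3 a (cross3 a (-g)))
      = -(α * ((a 1 * g 2 - a 2 * g 1) ^ 2 + (a 2 * g 0 - a 0 * g 2) ^ 2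
        + (a 0 * g 1 - a 1 * g 0) ^ 2)) := by
    simp [cross3, PiLp.inner_apply, Fin.sum_univ_three, cross_apply]
    ring
  rw [key]
  have : 0 ≤ α * ((a 1 * g 2 - a 2 * g 1) ^ 2 + (a 2 * g 0 - a 0 * g 2) ^ 2
        + (a 0 * g 1 - a 1 * g 0) ^ 2) := by positivity
  linarith

/-- Lyapunov structure: if `m` solves the Landau–Lifshitz equation with damping `α ≥ 0`
and effective field `h = −∇E(m)`, then the energy `t ↦ E(m t)` is nonincreasing. -/
theorem energy_nonincreasing (α : ℝ) (hα : 0 ≤ α) (E : E3 → ℝ) (hE : ContDiff ℝ 1 E)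
    (m : ℝ → E3) (hm : Differentiable ℝ m)
    (hLL : ∀ t : ℝ, deriv m t =
      -cross3 (m t) (-gradient E (m t))
        - α • cross3 (m t) (cross3 (m t) (-gradient E (m t)))) :
    Antitone (fun t : ℝ => E (m t)) := by
  have hd : ∀ t, HasDerivAt (fun t : ℝ => E (m t))
      (inner ℝ (gradient E (m t)) (deriv m t)) t := by
    intro t
    have h1 : HasGradientAt E (gradient E (m t)) (m t) :=
      ((hE.differentiable (by norm_num)) (m t)).hasGradientAt
    have h2 := h1.hasFDerivAt.comp_hasDerivAt t (hm t).hasDerivAt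
    rw [InnerProductSpace.toDual_apply_apply] at h2
    exact h2
  refine antitone_of_deriv_nonpos (fun t => (hd t).differentiableAt) (fun t => ?_)
  rw [(hd t).deriv, hLL t]
  exact cross3_ineq α hα _ _

end
end

section
/- Let α be a real number and let m, h ∈ ℝ³ with ‖m‖ = 1. Set v := −m × h − α m × (m × h). Then ⟨h, v⟩ = (α / (1 + α²)) ‖v‖². In particular, if α ≥ 0 then ⟨h, v⟩ ≥ 0. -/
open RealInnerProductSpace

noncomputable section

/-- For a unit vector `m`, the Landau–Lifshitz right-hand side
`v = −m × h − α m × (m × h)` satisfies `⟨h, v⟩ = (α/(1+α²)) ‖v‖²`;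
in particular `⟨h, v⟩ ≥ 0` whenever `α ≥ 0`. -/
theorem field_increment_inner (α : ℝ) (m h : E3) (hm : ‖m‖ = 1)
    (v : E3) (hv : v = -cross3 m h - α • cross3 m (cross3 m h)) :
    ⟪h, v⟫ = (α / (1 + α ^ 2)) * ‖v‖ ^ 2 ∧ (0 ≤ α → 0 ≤ ⟪h, v⟫) := by
  have hs : m 0 ^ 2 + m 1 ^ 2 + m 2 ^ 2 = 1 := by
    have h1 := EuclideanSpace.real_norm_sq_eq m
    rw [hm, Fin.sum_univ_three] at h1
    linarith
  have h0 : v 0 = -(m 1 * h 2 - m 2 * h 1) - α * (m 1 * (m 0 * h 1 - m 1 * h 0) - m 2 * (m 2 * h 0 - m 0 * h 2)) := by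
    simp [hv, cross3, cross_apply]
  have h1 : v 1 = -(m 2 * h 0 - m 0 * h 2) - α * (m 2 * (m 1 * h 2 - m 2 * h 1) - m 0 * (m 0 * h 1 - m 1 * h 0)) := by
    simp [hv, cross3, cross_apply]
  have h2 : v 2 = -(m 0 * h 1 - m 1 * h 0) - α * (m 0 * (m 2 * h 0 - m 0 * h 2) - m 1 * (m 1 * h 2 - m 2 * h 1)) := by
    simp [hv, cross3, cross_apply]
  have key : ⟪h, v⟫ = (α / (1 + α ^ 2)) * ‖v‖ ^ 2 := by
    have hpos : (1 + α ^ 2) ≠ 0 := by positivity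
    rw [EuclideanSpace.real_norm_sq_eq, PiLp.inner_apply, Fin.sum_univ_three, Fin.sum_univ_three,
      div_mul_eq_mul_div, eq_div_iff hpos]
    simp only [RCLike.inner_apply, conj_trivial]
    rw [h0, h1, h2]
    linear_combination (-(α ^ 3 * ((m 1 * h 2 - m 2 * h 1) ^ 2 + (m 2 * h 0 - m 0 * h 2) ^ 2
      + (m 0 * h 1 - m 1 * h 0) ^ 2))) * hs
  refine ⟨key, fun hα => ?_⟩
  rw [key]
  positivity

end
end

section
/- Let N be a positive integer, w : Fin N → ℝ with w_E > 0 for all E, and let 𝒬 = (Fin N → ℝ³) be equipped with the inner product ⟨u,v⟩_𝒬 = Σ_E w_E ⟨u_E, v_E⟩. Let ℱ be a finite-dimensional real inner product space, and let D : ℱ → 𝒬 and G : 𝒬 → ℱ be linear maps satisfying the discrete duality ⟨m, D p⟩_𝒬 = −⟨G m, p⟩_ℱ for all m ∈ 𝒬, p ∈ ℱ. Let α > 0, k > 0 and θ ∈ ℝ. Suppose m ∈ 𝒬 satisfies ‖m_E‖ = 1 for all E, and suppose v ∈ 𝒬 satisfies the θ-scheme relation: setting p := G(m + θ k v), for every E,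 v_E = −m_E × (D p)_E − α ⟨m_E, (D p)_E⟩ m_E + α (D p)_E. Then the energy identity holds: ‖G(m + k v)‖²_ℱ = ‖G m‖²_ℱ − (2 α k / (1 + α²)) ‖v‖²_𝒬 + k² (1 − 2θ) ‖G v‖²_ℱ. -/
open RealInnerProductSpace

noncomputable section

theorem pointwise_aux (α : ℝ) (m h v : E3) (hm : ‖m‖ = 1)
    (hv : v = -cross3 m h - (α * ⟪m, h⟫) • m + α • h) :
    (1 + α ^ 2) * ⟪v, h⟫ = α * ‖v‖ ^ 2 := by
  have h1 : ‖m‖ ^ 2 = 1 := by rw [hm]; norm_num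
  rw [← real_inner_self_eq_norm_sq] at h1 ⊢
  subst hv
  simp only [cross3, PiLp.inner_apply, Fin.sum_univ_three, crossProduct, RCLike.inner_apply,
    conj_trivial] at h1 ⊢
  simp at h1 ⊢
  linear_combination (-(α * (h 0 ^ 2 + h 1 ^ 2 + h 2 ^ 2) +
    α ^ 3 * (m 0 * h 0 + m 1 * h 1 + m 2 * h 2) ^ 2)) * h1

/-- Energy identity for the θ-scheme of the mimetic finite difference discretization of the
Landau–Lifshitz equation.  Here `D` is the discrete divergence, `G` the discrete gradient,
related by the discrete duality `⟨m, D p⟩_𝒬 = −⟨G m, p⟩_ℱ`, where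
`⟨u, v⟩_𝒬 = Σ_E w_E ⟨u_E, v_E⟩` is the weighted inner product on grid functions. -/
theorem theta_scheme_energy_identity (N : ℕ) (hN : 0 < N)
    (w : Fin N → ℝ) (hw : ∀ E, 0 < w E)
    {F : Type*} [NormedAddCommGroup F] [InnerProductSpace ℝ F] [FiniteDimensional ℝ F]
    (D : F →ₗ[ℝ] (Fin N → E3)) (G : (Fin N → E3) →ₗ[ℝ] F)
    (hduality : ∀ (m : Fin N → E3) (p : F),
      ∑ E, w E * ⟪m E, D p E⟫ = -⟪G m, p⟫)
    (α k θ : ℝ) (hα : 0 < α) (hk : 0 < k)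
    (m v : Fin N → E3) (hm : ∀ E, ‖m E‖ = 1)
    (hscheme : ∀ E, v E =
      -cross3 (m E) (D (G (m + (θ * k) • v)) E)
        - (α * ⟪m E, D (G (m + (θ * k) • v)) E⟫) • m E
        + α • D (G (m + (θ * k) • v)) E) :
    ‖G (m + k • v)‖ ^ 2 =
      ‖G m‖ ^ 2 - (2 * α * k / (1 + α ^ 2)) * (∑ E, w E * ‖v E‖ ^ 2)
        + k ^ 2 * (1 - 2 * θ) * ‖G v‖ ^ 2 := by
  have hp := fun E => pointwise_aux α (m E) _ (v E) (hm E) (hscheme E)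
  have hd := hduality v (G (m + (θ * k) • v))
  have hs : (1 + α ^ 2) * ∑ E, w E * ⟪v E, D (G (m + (θ * k) • v)) E⟫ =
      α * ∑ E, w E * ‖v E‖ ^ 2 := by
    rw [Finset.mul_sum, Finset.mul_sum]
    refine Finset.sum_congr rfl fun E _ => ?_
    linear_combination w E * hp E
  rw [hd, map_add, map_smul, inner_add_right, inner_smul_right,
    real_inner_self_eq_norm_sq] at hs
  have hpos : (1 + α ^ 2) ≠ 0 := by positivity
  rw [map_add, map_smul, norm_add_sq_real, inner_smul_right, norm_smul, mul_pow,
    Real.norm_eq_abs, sq_abs, real_inner_comm]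
  field_simp
  linear_combination (-2 * k) * hs

end
end

section
/- Let N be a positive integer, w : Fin N → ℝ with w_E > 0 for all E, and let 𝒬 = (Fin N → ℝ³) be equipped with the inner product ⟨u,v⟩_𝒬 = Σ_E w_E ⟨u_E, v_E⟩. Let ℱ be a finite-dimensional real inner product space, and let D : ℱ → 𝒬 and G : 𝒬 → ℱ be linear maps satisfying the discrete duality ⟨m, D p⟩_𝒬 = −⟨G m, p⟩_ℱ for all m ∈ 𝒬, p ∈ ℱ. Let α > 0 and k > 0. Suppose m ∈ 𝒬 satisfies ‖m_E‖ = 1 for all E, and suppose v ∈ 𝒬 satisfies the implicit (θ = 1) scheme relation: setting p := G(m + k v), for every E, v_E = −m_E × (D p)_E − α ⟨m_E, (D p)_E⟩ m_E + α (D p)_E. Then the discrete exchange energy does not increase: ‖G(m + k v)‖_ℱ ≤ ‖G m‖_ℱ. -/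
open RealInnerProductSpace

noncomputable section

/-- The implicit (θ = 1) mimetic finite difference scheme for the Landau–Lifshitz
equation does not increase the discrete exchange energy.  Here `D` is the discrete
divergence, `G` the discrete gradient, related by the discrete duality
`⟨m, D p⟩_𝒬 = −⟨G m, p⟩_ℱ`, where `⟨u, v⟩_𝒬 = Σ_E w_E ⟨u_E, v_E⟩`. -/
theorem implicit_scheme_energy_decrease (N : ℕ) (hN : 0 < N)
    (w : Fin N → ℝ) (hw : ∀ E, 0 < w E)
    {F : Type*} [NormedAddCommGroup F] [InnerProductSpace ℝ F] [FiniteDimensional ℝ F]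
    (D : F →ₗ[ℝ] (Fin N → E3)) (G : (Fin N → E3) →ₗ[ℝ] F)
    (hduality : ∀ (m : Fin N → E3) (p : F),
      ∑ E, w E * ⟪m E, D p E⟫ = -⟪G m, p⟫)
    (α k : ℝ) (hα : 0 < α) (hk : 0 < k)
    (m v : Fin N → E3) (hm : ∀ E, ‖m E‖ = 1)
    (hscheme : ∀ E, v E =
      -cross3 (m E) (D (G (m + k • v)) E)
        - (α * ⟪m E, D (G (m + k • v)) E⟫) • m E
        + α • D (G (m + k • v)) E) :
    ‖G (m + k • v)‖ ≤ ‖G m‖ := by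
  set p := G (m + k • v) with hp
  have hcross : ∀ a b : E3, ⟪cross3 a b, b⟫ = 0 := by
    intro a b
    simp [cross3, PiLp.inner_apply, Fin.sum_univ_three, cross_apply]
    ring
  have h1 : 0 ≤ ∑ E, w E * ⟪v E, D p E⟫ := by
    refine Finset.sum_nonneg fun E _ => mul_nonneg (hw E).le ?_
    have hc := abs_real_inner_le_norm (m E) (D p E)
    rw [hm E, one_mul] at hc
    have hsq : ⟪m E, D p E⟫ ^ 2 ≤ ‖D p E‖ ^ 2 := by
      rw [← sq_abs]
      exact pow_le_pow_left₀ (abs_nonneg _) hc 2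
    rw [hscheme E, inner_add_left, inner_sub_left, inner_neg_left, hcross,
      real_inner_smul_left, real_inner_smul_left, real_inner_self_eq_norm_sq]
    nlinarith [mul_le_mul_of_nonneg_left hsq hα.le]
  have h2 : ⟪G v, p⟫ ≤ 0 := by
    have := hduality v p
    linarith
  have h3 : ‖p‖ ^ 2 = ⟪G m, p⟫ + k * ⟪G v, p⟫ := by
    rw [← real_inner_self_eq_norm_sq, ← real_inner_smul_left, ← inner_add_left, ← map_smul,
      ← map_add]
  have h4 := real_inner_le_norm (G m) p
  have h5 : k * ⟪G v, p⟫ ≤ 0 := mul_nonpos_of_nonneg_of_nonpos hk.le h2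
  by_contra hlt
  push Not at hlt
  have := norm_nonneg (G m)
  nlinarith

end
end

section
/- Let N be a positive integer, w : Fin N → ℝ with w_E > 0 for all E, and let 𝒬 = (Fin N → ℝ³) be equipped with the inner product ⟨u,v⟩_𝒬 = Σ_E w_E ⟨u_E, v_E⟩. Let ℱ be a finite-dimensional real inner product space, and let D : ℱ → 𝒬 and G : 𝒬 → ℱ be linear maps satisfying the discrete duality ⟨m, D p⟩_𝒬 = −⟨G m, p⟩_ℱ for all m ∈ 𝒬, p ∈ ℱ. Let α > 0, k > 0, h > 0, C₁ > 0, and assume the inverse estimate ‖G u‖²_ℱ ≤ (C₁ / h²) ‖u‖²_𝒬 holds for all u ∈ 𝒬, together with the Courant condition k / h² ≤ 2α / (C₁ (1 + α²)). Suppose m ∈ 𝒬 satisfies ‖m_E‖ = 1 for all E, and define v ∈ 𝒬 by the explicit (θ = 0) scheme: setting p := G m, for every E, v_E := −m_E × (D p)_E − α ⟨m_E, (D p)_E⟩ m_E + α (D p)_E. Then the discrete exchange energy does not increase: ‖G(m + k v)‖_ℱ ≤ ‖G m‖_ℱ. -/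
open RealInnerProductSpace

noncomputable section

theorem aux_pointwise (a b v : E3) (α : ℝ) (ha : ‖a‖ = 1)
    (hv : v = -cross3 a b - (α * ⟪a, b⟫) • a + α • b) :
    (1 + α ^ 2) * ⟪v, b⟫ = α * ‖v‖ ^ 2 := by
  have h1 : a 0 ^ 2 + a 1 ^ 2 + a 2 ^ 2 = 1 := by
    have := EuclideanSpace.real_norm_sq_eq a
    rw [ha, Fin.sum_univ_three] at this
    linarith
  have hab : ⟪a, b⟫ = a 0 * b 0 + a 1 * b 1 + a 2 * b 2 := by
    simp [PiLp.inner_apply, Fin.sum_univ_three]; ring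
  have v0 : v 0 = -(a 1 * b 2 - a 2 * b 1) - α * ⟪a, b⟫ * a 0 + α * b 0 := by
    rw [hv]; simp [cross3, crossProduct]
  have v1 : v 1 = -(a 2 * b 0 - a 0 * b 2) - α * ⟪a, b⟫ * a 1 + α * b 1 := by
    rw [hv]; simp [cross3, crossProduct]
  have v2 : v 2 = -(a 0 * b 1 - a 1 * b 0) - α * ⟪a, b⟫ * a 2 + α * b 2 := by
    rw [hv]; simp [cross3, crossProduct]
  have hvb : ⟪v, b⟫ = v 0 * b 0 + v 1 * b 1 + v 2 * b 2 := by
    simp [PiLp.inner_apply, Fin.sum_univ_three]; ring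
  rw [hvb, EuclideanSpace.real_norm_sq_eq v, Fin.sum_univ_three, v0, v1, v2, hab]
  generalize a 0 = x at *
  generalize a 1 = y at *
  generalize a 2 = z at *
  generalize b 0 = p at *
  generalize b 1 = q at *
  generalize b 2 = r at *
  have e1 : (-(y * r - z * q) - α * (x * p + y * q + z * r) * x + α * p) * p
      + (-(z * p - x * r) - α * (x * p + y * q + z * r) * y + α * q) * q
      + (-(x * q - y * p) - α * (x * p + y * q + z * r) * z + α * r) * r
      = α * ((p^2+q^2+r^2) - (x * p + y * q + z * r)^2) := by ring
  have e2 : (-(y * r - z * q) - α * (x * p + y * q + z * r) * x + α * p) ^ 2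
      + (-(z * p - x * r) - α * (x * p + y * q + z * r) * y + α * q) ^ 2
      + (-(x * q - y * p) - α * (x * p + y * q + z * r) * z + α * r) ^ 2
      = (1 + α^2) * ((p^2+q^2+r^2) - (x * p + y * q + z * r)^2) := by
    linear_combination ((p^2+q^2+r^2) + α^2 * (x * p + y * q + z * r)^2) * h1
  rw [e1, e2]; ring

/-- Under the inverse estimate `‖G u‖² ≤ (C₁/h²) ‖u‖²_𝒬` and the Courant condition
`k/h² ≤ 2α/(C₁(1+α²))`, the explicit (θ = 0) mimetic finite difference scheme for the
Landau–Lifshitz equation does not increase the discrete exchange energy.  Here `D` is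
the discrete divergence, `G` the discrete gradient, related by the discrete duality
`⟨m, D p⟩_𝒬 = −⟨G m, p⟩_ℱ`, where `⟨u, v⟩_𝒬 = Σ_E w_E ⟨u_E, v_E⟩`. -/
theorem explicit_scheme_energy_decrease (N : ℕ) (hN : 0 < N)
    (w : Fin N → ℝ) (hw : ∀ E, 0 < w E)
    {F : Type*} [NormedAddCommGroup F] [InnerProductSpace ℝ F] [FiniteDimensional ℝ F]
    (D : F →ₗ[ℝ] (Fin N → E3)) (G : (Fin N → E3) →ₗ[ℝ] F)
    (hduality : ∀ (m : Fin N → E3) (p : F),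
      ∑ E, w E * ⟪m E, D p E⟫ = -⟪G m, p⟫)
    (α k h C₁ : ℝ) (hα : 0 < α) (hk : 0 < k) (hh : 0 < h) (hC₁ : 0 < C₁)
    (hinv : ∀ u : Fin N → E3, ‖G u‖ ^ 2 ≤ (C₁ / h ^ 2) * ∑ E, w E * ‖u E‖ ^ 2)
    (hcourant : k / h ^ 2 ≤ 2 * α / (C₁ * (1 + α ^ 2)))
    (m : Fin N → E3) (hm : ∀ E, ‖m E‖ = 1)
    (v : Fin N → E3)
    (hv : ∀ E, v E =
      -cross3 (m E) (D (G m) E)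
        - (α * ⟪m E, D (G m) E⟫) • m E
        + α • D (G m) E) :
    ‖G (m + k • v)‖ ≤ ‖G m‖ := by
  have hS : (1 + α ^ 2) * ⟪G v, G m⟫ = -(α * ∑ E, w E * ‖v E‖ ^ 2) := by
    have h1 := hduality v (G m)
    have h2 : ⟪G v, G m⟫ = -∑ E, w E * ⟪v E, D (G m) E⟫ := by rw [h1]; ring
    rw [h2, mul_neg, Finset.mul_sum, Finset.mul_sum]
    congr 1
    refine Finset.sum_congr rfl fun E _ => ?_
    have := aux_pointwise (m E) (D (G m) E) (v E) α (hm E) (hv E)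
    linear_combination w E * this
  have hI := hinv v
  have hS0 : 0 ≤ ∑ E, w E * ‖v E‖ ^ 2 :=
    Finset.sum_nonneg fun E _ => mul_nonneg (hw E).le (sq_nonneg _)
  generalize (∑ E, w E * ‖v E‖ ^ 2) = S at hS hI hS0
  have hpos : 0 < 1 + α ^ 2 := by positivity
  have hc : (1 + α ^ 2) * (k * (C₁ / h ^ 2)) ≤ 2 * α := by
    rw [le_div_iff₀ (by positivity)] at hcourant
    calc (1 + α ^ 2) * (k * (C₁ / h ^ 2)) = k / h ^ 2 * (C₁ * (1 + α ^ 2)) := by ring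
      _ ≤ _ := hcourant
  have key : 2 * ⟪G v, G m⟫ + k * ‖G v‖ ^ 2 ≤ 0 := by
    have h1 : (1 + α ^ 2) * (k * ‖G v‖ ^ 2) ≤ (1 + α ^ 2) * (k * (C₁ / h ^ 2 * S)) := by
      gcongr
    have h2 := mul_le_mul_of_nonneg_right hc hS0
    have h3 : (1 + α ^ 2) * (2 * ⟪G v, G m⟫ + k * ‖G v‖ ^ 2) ≤ 0 := by linarith
    exact nonpos_of_mul_nonpos_right h3 hpos
  have hexp : ‖G (m + k • v)‖ ^ 2
      = ‖G m‖ ^ 2 + k * (2 * ⟪G v, G m⟫ + k * ‖G v‖ ^ 2) := by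
    rw [map_add, map_smul, norm_add_sq_real, inner_smul_right, norm_smul, mul_pow,
      Real.norm_eq_abs, sq_abs, real_inner_comm]
    ring
  have h4 := mul_nonpos_of_nonneg_of_nonpos hk.le key
  exact (sq_le_sq₀ (norm_nonneg _) (norm_nonneg _)).mp (by linarith)

end
end

section
/- Let n be a positive integer and let β : Fin n → Fin n → ℝ satisfy β i j = β j i and β i j ≥ 0 for all i, j. Let v̂ : Fin n → ℝ³ satisfy ‖v̂ i‖ ≥ 1 for every i, and define the renormalized vectors v i := v̂ i / ‖v̂ i‖. Then the weighted graph energy decreases under renormalization: Σ_{i,j} β i j ‖v i − v j‖² ≤ Σ_{i,j} β i j ‖v̂ i − v̂ j‖². -/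
noncomputable section

/-- Renormalization onto the unit sphere decreases the weighted graph energy:
if `β` is a symmetric array of nonnegative weights and `‖v̂ i‖ ≥ 1` for all `i`,
then with `v i := v̂ i / ‖v̂ i‖` we have
`Σ_{i,j} β i j ‖v i − v j‖² ≤ Σ_{i,j} β i j ‖v̂ i − v̂ j‖²`. -/
theorem renormalization_graph_energy_decrease (n : ℕ) (hn : 0 < n)
    (β : Fin n → Fin n → ℝ) (hsymm : ∀ i j, β i j = β j i) (hpos : ∀ i j, 0 ≤ β i j)
    (vhat : Fin n → E3) (hvhat : ∀ i, 1 ≤ ‖vhat i‖)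
    (v : Fin n → E3) (hv : ∀ i, v i = ‖vhat i‖⁻¹ • vhat i) :
    ∑ i, ∑ j, β i j * ‖v i - v j‖ ^ 2 ≤ ∑ i, ∑ j, β i j * ‖vhat i - vhat j‖ ^ 2 := by
  have hn1 : ∀ i, ‖v i‖ = 1 := by
    intro i
    have h0 : 0 < ‖vhat i‖ := by linarith [hvhat i]
    rw [hv, norm_smul, norm_inv, norm_norm, inv_mul_cancel₀ h0.ne']
  have hw : ∀ i, vhat i = ‖vhat i‖ • v i := by
    intro i
    have h0 : 0 < ‖vhat i‖ := by linarith [hvhat i]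
    rw [hv, smul_smul, mul_inv_cancel₀ h0.ne', one_smul]
  refine Finset.sum_le_sum fun i _ => Finset.sum_le_sum fun j _ =>
    mul_le_mul_of_nonneg_left ?_ (hpos i j)
  have hc : inner ℝ (v i) (v j) ≤ 1 := by
    have := real_inner_le_norm (v i) (v j)
    rwa [hn1, hn1, one_mul] at this
  have hin : inner ℝ (vhat i) (vhat j) = ‖vhat i‖ * ‖vhat j‖ * inner ℝ (v i) (v j) := by
    conv_lhs => rw [hw i, hw j]
    rw [real_inner_smul_left, real_inner_smul_right]
    ring
  rw [norm_sub_sq_real, norm_sub_sq_real, hin, hn1, hn1]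
  have hab : 1 ≤ ‖vhat i‖ * ‖vhat j‖ := one_le_mul_of_one_le_of_one_le (hvhat i) (hvhat j)
  nlinarith [sq_nonneg (‖vhat i‖ - ‖vhat j‖), mul_nonneg (sub_nonneg.2 hab) (sub_nonneg.2 hc)]

end
end

section
/- Let n be a positive integer, c > 0 a real number, and let N and R be n × 3 real matrices with Rᵀ N = c I₃ (which forces N to have full column rank, so Nᵀ N is invertible). Let G be a symmetric positive definite n × n real matrix, and set P := Iₙ − N (Nᵀ N)⁻¹ Nᵀ (the orthogonal projection onto the orthogonal complement of the column space of N) and M := (1/c) R Rᵀ + P G P. Then M is symmetric, M N = R, and M is positive definite. -/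
open Matrix

/-- The family of elemental mimetic inner-product matrices: if `Rᵀ N = c I₃` with `c > 0`,
`G` is symmetric positive definite, `P = I − N (NᵀN)⁻¹ Nᵀ` is the orthogonal projection
onto the orthogonal complement of the column space of `N`, and
`M = (1/c) R Rᵀ + P G P`, then `M` is symmetric, satisfies the consistency condition
`M N = R`, and is positive definite. -/
theorem mimetic_inner_product_matrix (n : ℕ) (hn : 0 < n) (c : ℝ) (hc : 0 < c)
    (N R : Matrix (Fin n) (Fin 3) ℝ) (hNR : Rᵀ * N = c • (1 : Matrix (Fin 3) (Fin 3) ℝ))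
    (G : Matrix (Fin n) (Fin n) ℝ) (hG : G.PosDef)
    (P : Matrix (Fin n) (Fin n) ℝ) (hP : P = 1 - N * (Nᵀ * N)⁻¹ * Nᵀ)
    (M : Matrix (Fin n) (Fin n) ℝ) (hM : M = c⁻¹ • (R * Rᵀ) + P * G * P) :
    M.IsSymm ∧ M * N = R ∧ M.PosDef := by
  have hinj : Function.Injective N.mulVec := by
    intro x y hxy
    have h := congrArg (fun v => Rᵀ *ᵥ v) hxy
    simp only [mulVec_mulVec, hNR, smul_mulVec, one_mulVec] at h
    exact smul_right_injective _ hc.ne' h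
  have hNN : (Nᵀ * N).PosDef := by
    simpa using Matrix.PosDef.conjTranspose_mul_self N hinj
  have hu : IsUnit (Nᵀ * N).det := (Matrix.isUnit_iff_isUnit_det _).1 hNN.isUnit
  have hPN : P * N = 0 := by
    rw [hP, Matrix.sub_mul, Matrix.mul_assoc, Matrix.mul_assoc, Matrix.nonsing_inv_mul _ hu]
    simp
  have hPt : Pᵀ = P := by
    rw [hP]
    simp [Matrix.transpose_mul, Matrix.transpose_nonsing_inv, Matrix.mul_assoc]
  have hGt : Gᵀ = G := by simpa using hG.isHermitian.eq
  have hMt : Mᵀ = M := by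
    rw [hM]
    simp [Matrix.transpose_mul, hPt, hGt, Matrix.mul_assoc]
  refine ⟨hMt, ?_, ?_⟩
  · rw [hM, Matrix.add_mul, Matrix.mul_assoc (P * G), hPN, Matrix.smul_mul, Matrix.mul_assoc, hNR]
    simp [smul_smul, hc.ne']
  · refine Matrix.PosDef.of_dotProduct_mulVec_pos (by simpa [Matrix.IsHermitian] using hMt) ?_
    intro x hx
    have e : star x ⬝ᵥ (M *ᵥ x) = c⁻¹ * ((Rᵀ *ᵥ x) ⬝ᵥ (Rᵀ *ᵥ x))
        + (P *ᵥ x) ⬝ᵥ (G *ᵥ (P *ᵥ x)) := by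
      have h1 : (Rᵀ *ᵥ x) ⬝ᵥ (Rᵀ *ᵥ x) = x ⬝ᵥ ((R * Rᵀ) *ᵥ x) := by
        rw [← mulVec_mulVec, dotProduct_mulVec x R, mulVec_transpose]
      have h2 : (P *ᵥ x) ⬝ᵥ (G *ᵥ (P *ᵥ x)) = x ⬝ᵥ ((P * G * P) *ᵥ x) := by
        rw [← mulVec_mulVec, ← mulVec_mulVec, dotProduct_mulVec x P, ← mulVec_transpose, hPt]
      rw [h1, h2, hM, add_mulVec, smul_mulVec, dotProduct_add, dotProduct_smul]
      simp
    rw [e]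
    have hR0 : 0 ≤ (Rᵀ *ᵥ x) ⬝ᵥ (Rᵀ *ᵥ x) := by
      simpa using dotProduct_star_self_nonneg (Rᵀ *ᵥ x)
    have hci : 0 < c⁻¹ := inv_pos.2 hc
    by_cases hPx : P *ᵥ x = 0
    · have hxN : x = N *ᵥ (((Nᵀ * N)⁻¹ * Nᵀ) *ᵥ x) := by
        rw [hP, sub_mulVec, one_mulVec, sub_eq_zero] at hPx
        rw [mulVec_mulVec, ← Matrix.mul_assoc]
        exact hPx
      have hRx : Rᵀ *ᵥ x ≠ 0 := by
        intro h
        rw [hxN, mulVec_mulVec, hNR, smul_mulVec, one_mulVec] at h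
        have h0 := (smul_eq_zero.1 h).resolve_left hc.ne'
        rw [h0, mulVec_zero] at hxN
        exact hx hxN
      have : (Rᵀ *ᵥ x) ⬝ᵥ (Rᵀ *ᵥ x) ≠ 0 := fun h => hRx (dotProduct_self_eq_zero.1 h)
      have h3 : 0 < (Rᵀ *ᵥ x) ⬝ᵥ (Rᵀ *ᵥ x) := lt_of_le_of_ne hR0 this.symm
      rw [hPx]
      simp only [zero_dotProduct, add_zero]
      exact mul_pos hci h3
    · have h4 : 0 < (P *ᵥ x) ⬝ᵥ (G *ᵥ (P *ᵥ x)) := by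
        simpa using hG.dotProduct_mulVec_pos hPx
      have := mul_nonneg hci.le hR0
      linarith
end

section
/- Let α > 0, κ ∈ ℝ, and β ∈ (0, π/2). Define d(t) := √(sin²β + e^{4κ²αt} cos²β) and g(t) := (1/α) · log((d(t) + e^{2κ²αt} cos β)/(1 + cos β)), and define m : ℝ² × ℝ → ℝ³ by m_x(x₁,x₂,t) = (1/d(t)) sin β cos(κ(x₁+x₂) + g(t)), m_y(x₁,x₂,t) = (1/d(t)) sin β sin(κ(x₁+x₂) + g(t)), m_z(x₁,x₂,t) = (1/d(t)) e^{2κ²αt} cos β. Then ‖m(x₁,x₂,t)‖ = 1 for all (x₁,x₂,t), and m satisfies the Landau–Lifshitz equation with effective field equal to the Laplacian: ∂m/∂t = −m × Δm − α m × (m × Δm), where Δm = ∂²m/∂x₁² + ∂²m/∂x₂² is the componentwise spatial Laplacian. -/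
open Real

noncomputable section

/-- The normalization factor `d(t) = √(sin²β + e^{4κ²αt} cos²β)`. -/
def dsol (α κ β t : ℝ) : ℝ :=
  Real.sqrt (Real.sin β ^ 2 + Real.exp (4 * κ ^ 2 * α * t) * Real.cos β ^ 2)

/-- The phase `g(t) = (1/α) log((d(t) + e^{2κ²αt} cos β)/(1 + cos β))`. -/
def gsol (α κ β t : ℝ) : ℝ :=
  (1 / α) * Real.log ((dsol α κ β t + Real.exp (2 * κ ^ 2 * α * t) * Real.cos β)
    / (1 + Real.cos β))

/-- The analytical solution of the Landau–Lifshitz equation with pure exchange field. -/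
def msol (α κ β x₁ x₂ t : ℝ) : E3 :=
  (WithLp.equiv 2 (Fin 3 → ℝ)).symm
    ![(1 / dsol α κ β t) * Real.sin β * Real.cos (κ * (x₁ + x₂) + gsol α κ β t),
      (1 / dsol α κ β t) * Real.sin β * Real.sin (κ * (x₁ + x₂) + gsol α κ β t),
      (1 / dsol α κ β t) * Real.exp (2 * κ ^ 2 * α * t) * Real.cos β]

/-- The componentwise spatial Laplacian `Δm = ∂²m/∂x₁² + ∂²m/∂x₂²` of the analytical
solution. -/
def lapmsol (α κ β x₁ x₂ t : ℝ) : E3 :=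
  deriv (fun y => deriv (fun z => msol α κ β z x₂ t) y) x₁ +
    deriv (fun y => deriv (fun z => msol α κ β x₁ z t) y) x₂

theorem aux_vec {f0 f1 f2 : ℝ → ℝ} {a b c t : ℝ} (h0 : HasDerivAt f0 a t)
    (h1 : HasDerivAt f1 b t) (h2 : HasDerivAt f2 c t) :
    HasDerivAt (fun s => ((WithLp.equiv 2 (Fin 3 → ℝ)).symm ![f0 s, f1 s, f2 s] : E3))
      ((WithLp.equiv 2 (Fin 3 → ℝ)).symm ![a, b, c]) t := by
  have h : HasDerivAt (fun s => ![f0 s, f1 s, f2 s]) ![a, b, c] t := by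
    rw [hasDerivAt_pi]
    intro i
    fin_cases i
    · exact h0
    · exact h1
    · exact h2
  exact (PiLp.hasFDerivAt_toLp 2 _).comp_hasDerivAt t h

theorem aux_d_sq (α κ β t : ℝ) (hβ : β ∈ Set.Ioo 0 (π / 2)) :
    0 < dsol α κ β t ∧ dsol α κ β t ^ 2 =
      Real.sin β ^ 2 + Real.exp (2 * κ ^ 2 * α * t) ^ 2 * Real.cos β ^ 2 := by
  have hs : 0 < Real.sin β := Real.sin_pos_of_pos_of_lt_pi hβ.1 (by linarith [hβ.2, Real.pi_pos])
  have he : Real.exp (4 * κ ^ 2 * α * t) = Real.exp (2 * κ ^ 2 * α * t) ^ 2 := by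
    rw [← Real.exp_nat_mul]; congr 1; push_cast; ring
  unfold dsol
  refine ⟨Real.sqrt_pos.2 (by positivity), ?_⟩
  rw [Real.sq_sqrt (by positivity), he]

theorem aux_d (α κ β t : ℝ) (hβ : β ∈ Set.Ioo 0 (π / 2)) :
    HasDerivAt (fun s => dsol α κ β s) (2 * κ ^ 2 * α *
      (Real.exp (2 * κ ^ 2 * α * t) * Real.cos β) ^ 2 / dsol α κ β t) t := by
  obtain ⟨hd, hd2⟩ := aux_d_sq α κ β t hβ
  have he : Real.exp (4 * κ ^ 2 * α * t) = Real.exp (2 * κ ^ 2 * α * t) ^ 2 := by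
    rw [← Real.exp_nat_mul]; congr 1; push_cast; ring
  have h1 : HasDerivAt (fun s => Real.sin β ^ 2 + Real.exp (4 * κ ^ 2 * α * s) * Real.cos β ^ 2)
      (Real.exp (4 * κ ^ 2 * α * t) * (4 * κ ^ 2 * α * 1) * Real.cos β ^ 2) t :=
    ((((hasDerivAt_id t).const_mul (4 * κ ^ 2 * α)).exp).mul_const _).const_add _
  have h2 := h1.sqrt (by rw [he, ← hd2]; positivity)
  refine h2.congr_deriv ?_
  change _ / (2 * dsol α κ β t) = _
  rw [he]
  field_simp
  ring

theorem aux_e (α κ t : ℝ) : HasDerivAt (fun s => Real.exp (2 * κ ^ 2 * α * s))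
    (2 * κ ^ 2 * α * Real.exp (2 * κ ^ 2 * α * t)) t := by
  refine (((hasDerivAt_id t).const_mul (2 * κ ^ 2 * α)).exp).congr_deriv ?_
  simp only [id]
  ring

theorem aux_g (α κ β t : ℝ) (hα : 0 < α) (hβ : β ∈ Set.Ioo 0 (π / 2)) :
    HasDerivAt (fun s => gsol α κ β s) (2 * κ ^ 2 *
      (Real.exp (2 * κ ^ 2 * α * t) * Real.cos β) / dsol α κ β t) t := by
  obtain ⟨hd, hd2⟩ := aux_d_sq α κ β t hβ
  have hc : 0 < Real.cos β := Real.cos_pos_of_mem_Ioo ⟨by linarith [hβ.1, Real.pi_pos], hβ.2⟩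
  have hE := Real.exp_pos (2 * κ ^ 2 * α * t)
  have h1 := ((((aux_d α κ β t hβ).add ((aux_e α κ t).mul_const (Real.cos β))).div_const
    (1 + Real.cos β)).log (by simp only [Pi.add_apply]; positivity)).const_mul (1 / α)
  refine h1.congr_deriv ?_
  simp only [Pi.add_apply]
  have : 0 < dsol α κ β t + Real.exp (2 * κ ^ 2 * α * t) * Real.cos β := by positivity
  field_simp
  ring

theorem aux_x (A B k q x : ℝ) :
    deriv (fun y => deriv (fun z => ((WithLp.equiv 2 (Fin 3 → ℝ)).symm
      ![A * Real.cos (k * z + q), A * Real.sin (k * z + q), B] : E3)) y) x =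
    (WithLp.equiv 2 (Fin 3 → ℝ)).symm
      ![-k ^ 2 * (A * Real.cos (k * x + q)), -k ^ 2 * (A * Real.sin (k * x + q)), 0] := by
  have hl : ∀ y, HasDerivAt (fun z => k * z + q) k y := fun y => by
    simpa using ((hasDerivAt_id y).const_mul k).add_const q
  have h1 : ∀ y, deriv (fun z => ((WithLp.equiv 2 (Fin 3 → ℝ)).symm
      ![A * Real.cos (k * z + q), A * Real.sin (k * z + q), B] : E3)) y =
      (WithLp.equiv 2 (Fin 3 → ℝ)).symm
      ![A * (-Real.sin (k * y + q) * k), A * (Real.cos (k * y + q) * k), 0] := fun y =>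
    (aux_vec ((hl y).cos.const_mul A) ((hl y).sin.const_mul A) (hasDerivAt_const y B)).deriv
  simp only [h1]
  refine (aux_vec (((hl x).sin.neg.mul_const k).const_mul A)
    (((hl x).cos.mul_const k).const_mul A) (hasDerivAt_const x 0)).deriv.trans ?_
  congr 1
  ext i
  fin_cases i <;> simp <;> ring

theorem aux_lap (α κ β x₁ x₂ t : ℝ) : lapmsol α κ β x₁ x₂ t =
    (WithLp.equiv 2 (Fin 3 → ℝ)).symm
      ![-2 * κ ^ 2 * ((1 / dsol α κ β t) * Real.sin β *
          Real.cos (κ * (x₁ + x₂) + gsol α κ β t)),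
        -2 * κ ^ 2 * ((1 / dsol α κ β t) * Real.sin β *
          Real.sin (κ * (x₁ + x₂) + gsol α κ β t)), 0] := by
  have e1 : ∀ z, κ * (z + x₂) + gsol α κ β t = κ * z + (κ * x₂ + gsol α κ β t) :=
    fun z => by ring
  have e2 : ∀ z, κ * (x₁ + z) + gsol α κ β t = κ * z + (κ * x₁ + gsol α κ β t) :=
    fun z => by ring
  have h1 := aux_x ((1 / dsol α κ β t) * Real.sin β)
    ((1 / dsol α κ β t) * Real.exp (2 * κ ^ 2 * α * t) * Real.cos β) κ (κ * x₂ + gsol α κ β t) x₁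
  have h2 := aux_x ((1 / dsol α κ β t) * Real.sin β)
    ((1 / dsol α κ β t) * Real.exp (2 * κ ^ 2 * α * t) * Real.cos β) κ (κ * x₁ + gsol α κ β t) x₂
  simp only [← e1] at h1
  simp only [← e2] at h2
  unfold lapmsol msol
  rw [h1, h2]
  ext i
  fin_cases i <;> simp <;> ring

/-- The analytical solution `msol` has unit magnitude and satisfies the Landau–Lifshitz
equation with effective field equal to the Laplacian:
`∂m/∂t = −m × Δm − α m × (m × Δm)`. -/
theorem analytic_solution_LL (α κ β : ℝ) (hα : 0 < α) (hβ : β ∈ Set.Ioo 0 (π / 2)) :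
    (∀ x₁ x₂ t : ℝ, ‖msol α κ β x₁ x₂ t‖ = 1) ∧
    (∀ x₁ x₂ t : ℝ,
      deriv (fun s => msol α κ β x₁ x₂ s) t =
        -cross3 (msol α κ β x₁ x₂ t) (lapmsol α κ β x₁ x₂ t)
          - α • cross3 (msol α κ β x₁ x₂ t)
              (cross3 (msol α κ β x₁ x₂ t) (lapmsol α κ β x₁ x₂ t))) := by
  have key : ∀ t, 0 < dsol α κ β t ∧ dsol α κ β t ^ 2 = _ := fun t => aux_d_sq α κ β t hβ
  constructor
  · intro x₁ x₂ t
    obtain ⟨hd, hd2⟩ := key t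
    have h : ‖msol α κ β x₁ x₂ t‖ ^ 2 = 1 := by
      rw [EuclideanSpace.norm_sq_eq]
      simp only [msol, Fin.sum_univ_three, Real.norm_eq_abs, sq_abs]
      simp
      have := Real.sin_sq_add_cos_sq (κ * (x₁ + x₂) + gsol α κ β t)
      generalize Real.exp (2 * κ ^ 2 * α * t) = E at *
      field_simp
      rw [hd2]
      linear_combination Real.sin β ^ 2 * this
    nlinarith [norm_nonneg (msol α κ β x₁ x₂ t)]
  · intro x₁ x₂ t
    obtain ⟨hd, hd2⟩ := key t
    have hi : HasDerivAt (fun s => 1 / dsol α κ β s) (-(2 * κ ^ 2 * α *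
      (Real.exp (2 * κ ^ 2 * α * t) * Real.cos β) ^ 2 / dsol α κ β t) / dsol α κ β t ^ 2) t := by
      simp only [one_div]
      exact (aux_d α κ β t hβ).inv hd.ne'
    have hp := (aux_g α κ β t hα hβ).const_add (κ * (x₁ + x₂))
    have h := aux_vec ((hi.mul_const (Real.sin β)).mul hp.cos)
      ((hi.mul_const (Real.sin β)).mul hp.sin) ((hi.mul (aux_e α κ t)).mul_const (Real.cos β))
    have h' : deriv (fun s => msol α κ β x₁ x₂ s) t = _ := h.deriv
    rw [h', aux_lap]
    have hsc := Real.sin_sq_add_cos_sq (κ * (x₁ + x₂) + gsol α κ β t)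
    unfold msol cross3
    generalize Real.sin (κ * (x₁ + x₂) + gsol α κ β t) = S at *
    generalize Real.cos (κ * (x₁ + x₂) + gsol α κ β t) = C at *
    generalize dsol α κ β t = d at *
    generalize Real.exp (2 * κ ^ 2 * α * t) = E at *
    ext i
    fin_cases i
    · simp [crossProduct]
      field_simp
      ring
    · simp [crossProduct]
      field_simp
      ring
    · simp [crossProduct]
      field_simp
      linear_combination κ ^ 2 * α * E * Real.cos β * hd2 - κ ^ 2 * α * E * Real.cos β * Real.sin β ^ 2 * hsc

end
end
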